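/- For every n ≥ 1, the map Ψ(B,b) = ( K(B,b), (tr B, tr B², …, tr Bⁿ) ), where K(B,b) is the n×n matrix whose columns are b, Bb, …, B^{n−1}b, is a bijection from V_n onto GL(n,ℂ) × ℂⁿ. -/

import Mathlib

open Matrix

noncomputable section

/-- The Krylov matrix of `(B, b)`, whose columns are `b, Bb, …, B^{n−1}b`. -/
def krylov {n : ℕ} (B : Matrix (Fin n) (Fin n) ℂ) (b : Fin n → ℂ) :
    Matrix (Fin n) (Fin n) ℂ :=
  fun i j => (B ^ (j : ℕ) *ᵥ b) i

/-- `b` is a cyclic vector for `B` if `b, Bb, …, B^{n−1}b` form a basis of `ℂⁿ`. -/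
def IsCyclic' {n : ℕ} (B : Matrix (Fin n) (Fin n) ℂ) (b : Fin n → ℂ) : Prop :=
  IsUnit (krylov B b)

/-- `V_n`, the set of pairs `(B, b)` with `b` cyclic for `B`. -/
def Vn (n : ℕ) : Set (Matrix (Fin n) (Fin n) ℂ × (Fin n → ℂ)) :=
  {p | IsCyclic' p.1 p.2}

open Polynomial in
theorem Matrix.det_aeval_eq_prod_roots_charpoly {K ι : Type*} [Field K] [IsAlgClosed K]
    [Fintype ι] [DecidableEq ι] (A : Matrix ι ι K) (q : K[X]) :
    (aeval A q).det = (A.charpoly.roots.map fun r => q.eval r).prod := by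
  have hcard : A.charpoly.roots.card = Fintype.card ι := by
    rw [IsAlgClosed.card_roots_eq_natDegree, charpoly_natDegree_eq_dim]
  have hlin (a : K) : (aeval A (X - C a)).det
      = (A.charpoly.roots.map fun r => (X - C a).eval r).prod := by
    have h1 : aeval A (X - C a) = -(scalar ι a - A) := by
      simp [Matrix.algebraMap_eq_diagonal, Pi.algebraMap_def]
    have h2 : A.charpoly.eval a = (A.charpoly.roots.map fun r => a - r).prod := by
      conv_lhs => rw [(IsAlgClosed.splits A.charpoly).eq_prod_roots_of_monic A.charpoly_monic]
      rw [eval_multiset_prod, Multiset.map_map]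
      simp
    rw [h1, det_neg, ← eval_charpoly, h2, ← hcard]
    simp only [eval_sub, eval_X, eval_C]
    rw [← Multiset.card_map (fun r => a - r), ← Multiset.prod_map_neg, Multiset.map_map]
    simp
  have hprod (s : Multiset K) : (aeval A (s.map fun a => X - C a).prod).det
      = (A.charpoly.roots.map fun r => (s.map fun a => X - C a).prod.eval r).prod := by
    induction s using Multiset.induction_on with
    | empty => simp
    | cons a s ih =>
      rw [Multiset.map_cons, Multiset.prod_cons, map_mul, det_mul, ih, hlin,
        ← Multiset.prod_map_mul]
      simp only [eval_mul]
  rw [(IsAlgClosed.splits q).eq_prod_roots, map_mul, det_mul, hprod]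
  simp only [eval_mul, Multiset.prod_map_mul, eval_C, Multiset.map_const', Multiset.prod_replicate,
    hcard]
  simp [Matrix.algebraMap_eq_diagonal, Pi.algebraMap_def]

open Polynomial in
theorem Matrix.roots_charpoly_pow {K ι : Type*} [Field K] [IsAlgClosed K]
    [Fintype ι] [DecidableEq ι] (A : Matrix ι ι K) (k : ℕ) :
    (A ^ k).charpoly.roots = A.charpoly.roots.map (· ^ k) := by
  have h : (A ^ k).charpoly = ((A.charpoly.roots.map (· ^ k)).map fun a => X - C a).prod := by
    have : Infinite K := IsAlgClosed.instInfinite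
    refine Polynomial.funext fun z => ?_
    have := A.det_aeval_eq_prod_roots_charpoly (C z - X ^ k)
    rw [eval_charpoly, eval_multiset_prod, Multiset.map_map, Multiset.map_map]
    simpa [Matrix.algebraMap_eq_diagonal, Pi.algebraMap_def] using this
  rw [h, roots_multiset_prod_X_sub_C]

theorem Matrix.trace_pow_eq_sum_roots_charpoly {K ι : Type*} [Field K] [IsAlgClosed K]
    [Fintype ι] [DecidableEq ι] (A : Matrix ι ι K) (k : ℕ) :
    (A ^ k).trace = (A.charpoly.roots.map (· ^ k)).sum := by
  rw [trace_eq_sum_roots_charpoly, roots_charpoly_pow]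

theorem Matrix.charpoly_coeff_eq_esymm {K ι : Type*} [Field K] [IsAlgClosed K]
    [Fintype ι] [DecidableEq ι] (A : Matrix ι ι K) {i : ℕ} (hi : i ≤ Fintype.card ι) :
    A.charpoly.coeff i
      = (-1) ^ (Fintype.card ι - i) * A.charpoly.roots.esymm (Fintype.card ι - i) := by
  rw [Polynomial.coeff_eq_esymm_roots_of_splits (IsAlgClosed.splits _)
    (by rwa [charpoly_natDegree_eq_dim]), A.charpoly_monic.leadingCoeff, one_mul,
    charpoly_natDegree_eq_dim]

/-- The sequences `e` and `p` satisfy Newton's identities, as the elementary symmetric functions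
and the power sums of a multiset do. -/
def SatisfiesNewton {K : Type*} [CommRing K] (e p : ℕ → K) : Prop :=
  e 0 = 1 ∧ ∀ k : ℕ, (k : K) * e k
    = (-1) ^ (k + 1) * ∑ i ∈ Finset.range k, (-1) ^ i * e i * p (k - i)

theorem Multiset.satisfiesNewton {K : Type*} [CommRing K] (s : Multiset K) :
    SatisfiesNewton s.esymm (fun k => (s.map (· ^ k)).sum) := by
  classical
  refine ⟨by simp [Multiset.esymm], fun k => ?_⟩
  have h := congrArg (MvPolynomial.aeval (fun x : s => (x : K)))
    (MvPolynomial.mul_esymm_eq_sum s K k)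
  have hp (j : ℕ) : MvPolynomial.aeval (fun x : s => (x : K)) (MvPolynomial.psum s K j)
      = (s.map (· ^ j)).sum := by
    conv_rhs => rw [← s.map_univ_coe, Multiset.map_map]
    simp [MvPolynomial.psum]
  simp only [map_mul, map_natCast, map_pow, map_neg, map_one, map_sum,
    MvPolynomial.aeval_esymm_eq_multiset_esymm, Multiset.map_univ_coe, hp] at h
  rw [h, Finset.sum_filter, Finset.Nat.sum_antidiagonal_eq_sum_range_succ_mk,
    Finset.sum_range_succ]
  congr 1
  simp only [lt_irrefl, if_false, add_zero]
  exact Finset.sum_congr rfl fun i hi => if_pos (Finset.mem_range.1 hi)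

namespace SatisfiesNewton

variable {K : Type*}

theorem left_unique [Field K] [CharZero K] {e e' p p' : ℕ → K} (h : SatisfiesNewton e p)
    (h' : SatisfiesNewton e' p') {n : ℕ} (hp : ∀ k < n, p (k + 1) = p' (k + 1)) :
    ∀ k ≤ n, e k = e' k := by
  intro k
  induction k using Nat.strong_induction_on with
  | _ k ih =>
    intro hk
    rcases k.eq_zero_or_pos with rfl | hpos
    · rw [h.1, h'.1]
    · have hk0 : (k : K) ≠ 0 := by exact_mod_cast hpos.ne'
      apply mul_left_cancel₀ hk0
      rw [h.2, h'.2]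
      congr 1
      refine Finset.sum_congr rfl fun i hi => ?_
      have hi := Finset.mem_range.1 hi
      rw [ih i hi (by omega), show k - i = (k - i - 1) + 1 by omega, hp _ (by omega)]

theorem right_unique [CommRing K] {e e' p p' : ℕ → K} (h : SatisfiesNewton e p)
    (h' : SatisfiesNewton e' p') {n : ℕ} (he : ∀ k ≤ n, e k = e' k) :
    ∀ k < n, p (k + 1) = p' (k + 1) := by
  intro k
  induction k using Nat.strong_induction_on with
  | _ k ih =>
    intro hk
    have h1 := h.2 (k + 1)
    rw [he _ hk, h'.2 (k + 1)] at h1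
    have h2 := ((isUnit_one (M := K)).neg.pow (k + 1 + 1)).mul_left_cancel h1
    rw [Finset.sum_range_succ', Finset.sum_range_succ', h.1, h'.1] at h2
    have h3 : ∑ i ∈ Finset.range k, (-1) ^ (i + 1) * e (i + 1) * p (k + 1 - (i + 1))
        = ∑ i ∈ Finset.range k, (-1) ^ (i + 1) * e' (i + 1) * p' (k + 1 - (i + 1)) := by
      refine Finset.sum_congr rfl fun i hi => ?_
      have hi := Finset.mem_range.1 hi
      rw [he _ (by omega), show k + 1 - (i + 1) = (k - i - 1) + 1 by omega,
        ih _ (by omega) (by omega)]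
    rw [h3] at h2
    simpa using (add_left_cancel h2).symm

/-- The sequence determined by Newton's identities from prescribed power sums `p`. -/
def ofPsum [Field K] (p : ℕ → K) : ℕ → K
  | 0 => 1
  | k + 1 => (-1) ^ k / ((k + 1 : ℕ) : K) *
      ∑ i : Fin (k + 1), (-1) ^ (i : ℕ) * ofPsum p i * p (k + 1 - i)
decreasing_by exact i.2

theorem satisfiesNewton_ofPsum [Field K] [CharZero K] (p : ℕ → K) :
    SatisfiesNewton (ofPsum p) p := by
  refine ⟨by rw [ofPsum], fun k => ?_⟩
  cases k with
  | zero => simp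
  | succ k =>
    have hk : ((k + 1 : ℕ) : K) ≠ 0 := by exact_mod_cast k.succ_ne_zero
    rw [ofPsum, ← mul_assoc, mul_div_cancel₀ _ hk,
      Finset.sum_range fun i => (-1) ^ i * ofPsum p i * p (k + 1 - i), pow_succ _ (k + 1),
      pow_succ]
    simp

end SatisfiesNewton

theorem krylov_col {n : ℕ} (B : Matrix (Fin n) (Fin n) ℂ) (b : Fin n → ℂ) (j : Fin n) :
    (krylov B b).col j = B ^ (j : ℕ) *ᵥ b := rfl

theorem krylov_mulVec_charpoly_coeff {n : ℕ} (B : Matrix (Fin n) (Fin n) ℂ) (b : Fin n → ℂ) :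
    krylov B b *ᵥ (fun i => B.charpoly.coeff i) = -(B ^ n *ᵥ b) := by
  have h := congrArg (· *ᵥ b) B.aeval_self_charpoly
  have hdeg : B.charpoly.natDegree = n := by simp [charpoly_natDegree_eq_dim]
  have hlead : B.charpoly.coeff n = 1 := by
    have := B.charpoly_monic.coeff_natDegree
    rwa [hdeg] at this
  simp only [Polynomial.aeval_eq_sum_range, hdeg, Finset.sum_range_succ, hlead, one_smul,
    add_mulVec, zero_mulVec] at h
  rw [← eq_neg_iff_add_eq_zero] at h
  rw [← h, Finset.sum_range, Matrix.sum_mulVec]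
  ext i
  simp [mulVec, dotProduct, krylov, Finset.sum_apply, smul_mulVec, mul_comm]

theorem eq_of_krylov_eq_of_trace_pow_eq {n : ℕ} (hn : 1 ≤ n) {B C : Matrix (Fin n) (Fin n) ℂ} {b c : Fin n → ℂ}
    (hB : IsUnit (krylov B b)) (hK : krylov B b = krylov C c)
    (ht : ∀ j : Fin n, (B ^ ((j : ℕ) + 1)).trace = (C ^ ((j : ℕ) + 1)).trace) :
    B = C ∧ b = c := by
  have hcol (j : Fin n) : B ^ (j : ℕ) *ᵥ b = C ^ (j : ℕ) *ᵥ c := by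
    rw [← krylov_col, ← krylov_col, hK]
  have hcoeff : (fun i : Fin n => B.charpoly.coeff i) = fun i : Fin n => C.charpoly.coeff i := by
    funext i
    have hi : (i : ℕ) ≤ Fintype.card (Fin n) := by simp
    rw [charpoly_coeff_eq_esymm _ hi, charpoly_coeff_eq_esymm _ hi]
    congr 1
    refine B.charpoly.roots.satisfiesNewton.left_unique C.charpoly.roots.satisfiesNewton
      (n := n) (fun k hk => ?_) _ (by simp)
    simpa only [trace_pow_eq_sum_roots_charpoly] using ht ⟨k, hk⟩
  have hpow : B ^ n *ᵥ b = C ^ n *ᵥ c := by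
    rw [← neg_inj, ← krylov_mulVec_charpoly_coeff, ← krylov_mulVec_charpoly_coeff, hK, hcoeff]
  have hmul : B * krylov B b = C * krylov B b := by
    refine ext_of_mulVec_single fun j => ?_
    rw [← mulVec_mulVec, ← mulVec_mulVec, mulVec_single_one, krylov_col]
    conv_rhs => rw [hcol]
    rw [mulVec_mulVec, mulVec_mulVec, ← pow_succ', ← pow_succ']
    rcases Nat.lt_or_ge ((j : ℕ) + 1) n with h | h
    · exact hcol ⟨_, h⟩
    · rwa [show (j : ℕ) + 1 = n by omega]
  refine ⟨hB.mul_right_cancel hmul, ?_⟩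
  simpa using hcol ⟨0, hn⟩

theorem exists_krylov_eq_of_pow_mulVec {n : ℕ} (hn : 1 ≤ n) {M : Matrix (Fin n) (Fin n) ℂ}
    (hM : IsUnit M) (v : Fin n → ℂ) :
    ∃ B b, krylov B b = M ∧ B ^ n *ᵥ b = v := by
  let N : Matrix (Fin n) (Fin n) ℂ :=
    fun i j => if h : (j : ℕ) + 1 < n then M i ⟨j + 1, h⟩ else v i
  have hNM : N * M⁻¹ * M = N := by
    rw [mul_assoc, nonsing_inv_mul _ ((isUnit_iff_isUnit_det _).1 hM), mul_one]
  have hstep (j : Fin n) : (N * M⁻¹) *ᵥ M.col j = N.col j := by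
    rw [← mulVec_single_one, mulVec_mulVec, hNM, mulVec_single_one]
  have hcol (j : ℕ) (hj : j < n) : (N * M⁻¹) ^ j *ᵥ M.col ⟨0, hn⟩ = M.col ⟨j, hj⟩ := by
    induction j with
    | zero => simp
    | succ j ih =>
      rw [pow_succ', ← mulVec_mulVec, ih (by omega), hstep]
      ext i
      exact dif_pos hj
  refine ⟨N * M⁻¹, M.col ⟨0, hn⟩, ?_, ?_⟩
  · ext i j
    exact congrFun (hcol j j.2) i
  · obtain ⟨m, rfl⟩ : ∃ m, n = m + 1 := ⟨n - 1, by omega⟩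
    rw [pow_succ', ← mulVec_mulVec, hcol m (by omega), hstep]
    ext i
    exact dif_neg (lt_irrefl _)

theorem exists_krylov_eq_and_trace_pow_eq {n : ℕ} (hn : 1 ≤ n) {M : Matrix (Fin n) (Fin n) ℂ} (hM : IsUnit M)
    (t : Fin n → ℂ) :
    ∃ B b, krylov B b = M ∧ ∀ j : Fin n, (B ^ ((j : ℕ) + 1)).trace = t j := by
  let p : ℕ → ℂ := fun k => if h : k - 1 < n then t ⟨k - 1, h⟩ else 0
  let e := SatisfiesNewton.ofPsum p
  have he : SatisfiesNewton e p := SatisfiesNewton.satisfiesNewton_ofPsum p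
  let c : Fin n → ℂ := fun i => (-1) ^ (n - i : ℕ) * e (n - i)
  obtain ⟨B, b, hK, hpow⟩ := exists_krylov_eq_of_pow_mulVec hn hM (-(M *ᵥ c))
  refine ⟨B, b, hK, fun j => ?_⟩
  have hc : (fun i : Fin n => B.charpoly.coeff i) = c := by
    apply mulVec_injective_of_isUnit hM
    have := krylov_mulVec_charpoly_coeff B b
    rwa [hK, hpow, neg_neg] at this
  have hesymm : ∀ k ≤ n, B.charpoly.roots.esymm k = e k := by
    intro k hk
    rcases k.eq_zero_or_pos with rfl | hpos
    · rw [he.1, B.charpoly.roots.satisfiesNewton.1]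
    · have h := congrFun hc ⟨n - k, by omega⟩
      simp only [c] at h
      rw [charpoly_coeff_eq_esymm _ (by simp), Fintype.card_fin, Nat.sub_sub_self hk] at h
      exact ((isUnit_one (M := ℂ)).neg.pow k).mul_left_cancel h
  have := B.charpoly.roots.satisfiesNewton.right_unique he hesymm j j.2
  rw [trace_pow_eq_sum_roots_charpoly, this]
  simp [p]

/-- The map `Ψ(B,b) = (K(B,b), (tr B, …, tr Bⁿ))` is a bijection from `V_n` onto
`GL(n,ℂ) × ℂⁿ`. -/
theorem Vn_biholo_GL_times_Cn (n : ℕ) (hn : 1 ≤ n) :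
    Set.BijOn
      (fun p : Matrix (Fin n) (Fin n) ℂ × (Fin n → ℂ) =>
        ((krylov p.1 p.2, fun j : Fin n => Matrix.trace (p.1 ^ ((j : ℕ) + 1))) :
          Matrix (Fin n) (Fin n) ℂ × (Fin n → ℂ)))
      (Vn n)
      ({M : Matrix (Fin n) (Fin n) ℂ | IsUnit M} ×ˢ (Set.univ : Set (Fin n → ℂ))) := by
  refine ⟨fun p hp => ⟨hp, Set.mem_univ _⟩, ?_, ?_⟩
  · rintro ⟨B, b⟩ hB ⟨C, c⟩ - h
    obtain ⟨h1, h2⟩ := Prod.ext_iff.1 h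
    obtain ⟨rfl, rfl⟩ := eq_of_krylov_eq_of_trace_pow_eq hn hB h1 (congrFun h2)
    rfl
  · rintro ⟨M, t⟩ ⟨hM, -⟩
    obtain ⟨B, b, rfl, ht⟩ := exists_krylov_eq_and_trace_pow_eq hn hM t
    exact ⟨(B, b), hM, Prod.ext rfl (funext ht)⟩
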